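/- Let Φ be the FJLT as in the context. Then for every fixed x ∈ ℝ^d, the variance of the normalized squared image is exactly Var[(1/k)·‖Φx‖₂²] = (1/k)·(2 + (9/d)·(1/q − 1))·‖x‖₂⁴ − (6/(d·k))·(1/q − 1)·‖x‖₄⁴, where ‖x‖₄⁴ = Σ_{j=1}^d x_j⁴. -/

import Mathlib

open MeasureTheory ProbabilityTheory Finset
open scoped ENNReal NNReal

/-- Uniform distribution on `{-1, +1} ⊆ ℝ` (law of a Rademacher sign). -/
noncomputable def signMeasure : Measure ℝ :=
  ((2 : ℝ≥0)⁻¹) • Measure.dirac (-1) + ((2 : ℝ≥0)⁻¹) • Measure.dirac 1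

instance : IsFiniteMeasure signMeasure := by unfold signMeasure; infer_instance

/-- Distribution of an entry of the FJLT matrix `P`: a sample of `N(0, 1/q)` with
probability `q` and `0` with probability `1 - q`. -/
noncomputable def fjltEntryMeasure (q : ℝ) : Measure ℝ :=
  q.toNNReal • gaussianReal 0 q.toNNReal⁻¹ + (1 - q).toNNReal • Measure.dirac 0

instance (q : ℝ) : IsFiniteMeasure (fjltEntryMeasure q) := by
  unfold fjltEntryMeasure; infer_instance

/-- The normalized `2^m × 2^m` Hadamard matrix: `H f j = d^{-1/2} * (-1)^{⟨f, j⟩}`,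
where `⟨f, j⟩` is the inner product of the binary expansions of `f` and `j`. -/
noncomputable def hadamardMat (m : ℕ) (f j : Fin (2 ^ m)) : ℝ :=
  (-1 : ℝ) ^ (∑ b ∈ Finset.range m, if f.val.testBit b && j.val.testBit b then 1 else 0) /
    Real.sqrt (2 ^ m)

/-- The `(i, j)` entry of the FJLT matrix `Φ = P·H·D`, given the realizations of the
sparse Gaussian matrix `P` and the diagonal sign vector `D`. -/
noncomputable def fjltEntry {m k : ℕ} (P : (Fin k × Fin (2 ^ m)) → ℝ)
    (D : Fin (2 ^ m) → ℝ) (i : Fin k) (j : Fin (2 ^ m)) : ℝ :=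
  ∑ f, P (i, f) * hadamardMat m f j * D j

lemma MeasureTheory.MemLp.integrable_pow_of_le {Ω : Type*} {_ : MeasurableSpace Ω}
    {μ : Measure Ω} [IsFiniteMeasure μ] {X : Ω → ℝ} {p n : ℕ} (hX : MemLp X p μ) (hn : n ≤ p) :
    Integrable (fun ω => X ω ^ n) μ := by
  have h : MemLp X n μ := hX.mono_exponent (by exact_mod_cast hn)
  have h' := h.integrable_norm_pow'
  refine (integrable_norm_iff (hX.aestronglyMeasurable.pow n)).1 ?_
  simpa only [norm_pow, Pi.pow_apply] using h'

/-- Second and fourth moments of a linear combination of independent centred variables of unit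
variance and fourth moment `t`. -/
lemma ProbabilityTheory.iIndepFun.integral_sum_sq_and_pow_four {Ω ι : Type*}
    {_ : MeasurableSpace Ω} {μ : Measure Ω} {ξ : ι → Ω → ℝ} {t : ℝ}
    (hind : iIndepFun ξ μ) (hmeas : ∀ a, Measurable (ξ a)) (hLp : ∀ a, MemLp (ξ a) 4 μ)
    (h1 : ∀ a, ∫ ω, ξ a ω ∂μ = 0) (h2 : ∀ a, ∫ ω, ξ a ω ^ 2 ∂μ = 1)
    (h4 : ∀ a, ∫ ω, ξ a ω ^ 4 ∂μ = t) (c : ι → ℝ) (s : Finset ι) :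
    ∫ ω, (∑ a ∈ s, ξ a ω * c a) ^ 2 ∂μ = ∑ a ∈ s, c a ^ 2 ∧
    ∫ ω, (∑ a ∈ s, ξ a ω * c a) ^ 4 ∂μ
      = 3 * (∑ a ∈ s, c a ^ 2) ^ 2 + (t - 3) * ∑ a ∈ s, c a ^ 4 := by
  classical
  have := hind.isProbabilityMeasure
  have hind' : iIndepFun (fun a ω => ξ a ω * c a) μ :=
    hind.comp (fun a y => y * c a) (fun a => by fun_prop)
  induction s using Finset.induction_on with
  | empty => simp
  | insert b s hb ih =>
    obtain ⟨ih2, ih4⟩ := ih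
    set S : Ω → ℝ := fun ω => ∑ a ∈ s, ξ a ω * c a with hS
    have hSLp : MemLp S (4 : ℕ) μ :=
      memLp_finsetSum s fun a _ => by simpa using (hLp a).mul_const (c a)
    have hbLp : MemLp (ξ b) (4 : ℕ) μ := by simpa using hLp b
    have hSξ : IndepFun S (fun ω => ξ b ω * c b) μ := by
      have := hind'.indepFun_finsetSum_of_notMem (fun a => by fun_prop) hb
      convert this using 1
      ext ω
      simp [hS]
    have hprod : ∀ i j : ℕ, i ≤ 4 → j ≤ 4 →
        Integrable (fun ω => S ω ^ i * (ξ b ω * c b) ^ j) μ ∧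
        ∫ ω, S ω ^ i * (ξ b ω * c b) ^ j ∂μ
          = (∫ ω, S ω ^ i ∂μ) * ((∫ ω, ξ b ω ^ j ∂μ) * c b ^ j) := by
      intro i j hi hj
      have hij : IndepFun (fun ω => S ω ^ i) (fun ω => (ξ b ω * c b) ^ j) μ :=
        hSξ.comp (φ := fun y => y ^ i) (ψ := fun y => y ^ j) (by fun_prop) (by fun_prop)
      have hSi := hSLp.integrable_pow_of_le hi
      have hbj := (hbLp.mul_const (c b)).integrable_pow_of_le hj
      refine ⟨hij.integrable_mul hSi hbj, ?_⟩
      rw [hij.integral_fun_mul_eq_mul_integral hSi.1 hbj.1]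
      simp only [mul_pow, integral_mul_const]
    have hS1 : ∫ ω, S ω ^ 1 ∂μ = 0 := by
      simp only [pow_one, hS]
      rw [integral_finsetSum _ fun a _ =>
        ((hLp a).integrable (by norm_num)).mul_const (c a)]
      simp [integral_mul_const, h1]
    have hb1 : ∫ ω, ξ b ω ^ 1 ∂μ = 0 := by simpa using h1 b
    simp only [Finset.sum_insert hb]
    constructor
    · have e : ∀ ω, (ξ b ω * c b + S ω) ^ 2
          = S ω ^ 2 * (ξ b ω * c b) ^ 0 + 2 * (S ω ^ 1 * (ξ b ω * c b) ^ 1)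
            + S ω ^ 0 * (ξ b ω * c b) ^ 2 := fun ω => by ring
      change ∫ ω, (ξ b ω * c b + S ω) ^ 2 ∂μ = _
      simp only [e]
      have i20 := hprod 2 0 (by norm_num) (by norm_num)
      have i11 := hprod 1 1 (by norm_num) (by norm_num)
      have i02 := hprod 0 2 (by norm_num) (by norm_num)
      rw [integral_add (i20.1.fun_add (i11.1.const_mul 2)) i02.1,
        integral_add i20.1 (i11.1.const_mul 2), integral_const_mul, i20.2, i11.2, i02.2,
        ih2, hS1, h2]
      simp
      ring
    · have e : ∀ ω, (ξ b ω * c b + S ω) ^ 4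
          = S ω ^ 4 * (ξ b ω * c b) ^ 0 + 4 * (S ω ^ 3 * (ξ b ω * c b) ^ 1)
            + 6 * (S ω ^ 2 * (ξ b ω * c b) ^ 2) + 4 * (S ω ^ 1 * (ξ b ω * c b) ^ 3)
            + S ω ^ 0 * (ξ b ω * c b) ^ 4 := fun ω => by ring
      change ∫ ω, (ξ b ω * c b + S ω) ^ 4 ∂μ = _
      simp only [e]
      have i40 := hprod 4 0 (by norm_num) (by norm_num)
      have i31 := hprod 3 1 (by norm_num) (by norm_num)
      have i22 := hprod 2 2 (by norm_num) (by norm_num)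
      have i13 := hprod 1 3 (by norm_num) (by norm_num)
      have i04 := hprod 0 4 (by norm_num) (by norm_num)
      have j1 := i40.1.fun_add (i31.1.const_mul 4)
      have j2 := j1.fun_add (i22.1.const_mul 6)
      have j3 := j2.fun_add (i13.1.const_mul 4)
      rw [integral_add j3 i04.1, integral_add j2 (i13.1.const_mul 4),
        integral_add j1 (i22.1.const_mul 6), integral_add i40.1 (i31.1.const_mul 4),
        integral_const_mul, integral_const_mul, integral_const_mul,
        i40.2, i31.2, i22.2, i13.2, i04.2, ih2, ih4, hS1, hb1, h2, h4]
      simp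
      ring

lemma integral_pow_four_gaussianReal (v : ℝ≥0) :
    ∫ y, y ^ 4 ∂gaussianReal 0 v = 3 * (v : ℝ) ^ 2 := by
  have hderiv : ∀ p p' : ℝ → ℝ, (∀ t, HasDerivAt p (p' t) t) →
      deriv (fun t => p t * Real.exp (v * t ^ 2 / 2))
        = fun t => (p' t + p t * (v * t)) * Real.exp (v * t ^ 2 / 2) := by
    intro p p' hp
    ext t
    have he : HasDerivAt (fun t : ℝ => (v : ℝ) * t ^ 2 / 2) (v * t) t :=
      (((hasDerivAt_pow 2 t).const_mul (v : ℝ)).div_const 2).congr_deriv (by push_cast; ring)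
    rw [((hp t).fun_mul he.exp).deriv]
    ring
  have hmgf : mgf (fun y : ℝ => y) (gaussianReal 0 v)
      = fun t => (1 : ℝ) * Real.exp (v * t ^ 2 / 2) := by
    rw [mgf_fun_id_gaussianReal]
    simp
  have d1 : deriv (fun t : ℝ => (1 : ℝ) * Real.exp (v * t ^ 2 / 2))
      = fun t => (v * t) * Real.exp (v * t ^ 2 / 2) := by
    simpa using hderiv (fun _ => 1) (fun _ => 0) fun t => hasDerivAt_const t 1
  have d2 : deriv (fun t : ℝ => (v * t) * Real.exp (v * t ^ 2 / 2))
      = fun t => (v + v ^ 2 * t ^ 2) * Real.exp (v * t ^ 2 / 2) := by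
    rw [hderiv _ (fun _ => (v : ℝ)) fun t => by simpa using (hasDerivAt_id t).const_mul (v : ℝ)]
    ext t
    ring
  have d3 : deriv (fun t : ℝ => (v + v ^ 2 * t ^ 2) * Real.exp (v * t ^ 2 / 2))
      = fun t => (3 * v ^ 2 * t + v ^ 3 * t ^ 3) * Real.exp (v * t ^ 2 / 2) := by
    rw [hderiv _ (fun t => v ^ 2 * (2 * t)) fun t => by
      simpa using ((hasDerivAt_pow 2 t).const_mul ((v : ℝ) ^ 2)).const_add (v : ℝ)]
    ext t
    ring
  have d4 : deriv (fun t : ℝ => (3 * v ^ 2 * t + v ^ 3 * t ^ 3) * Real.exp (v * t ^ 2 / 2)) 0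
      = 3 * (v : ℝ) ^ 2 := by
    rw [hderiv _ (fun t => 3 * v ^ 2 + v ^ 3 * (3 * t ^ 2)) fun t => by
      simpa using ((hasDerivAt_id t).const_mul (3 * (v : ℝ) ^ 2)).fun_add
        ((hasDerivAt_pow 3 t).const_mul ((v : ℝ) ^ 3))]
    simp
  have h := iteratedDeriv_mgf_zero (X := fun y : ℝ => y) (μ := gaussianReal 0 v) (by simp) 4
  simp only [hmgf, iteratedDeriv_eq_iterate, Function.iterate_succ, Function.iterate_zero,
    Function.comp_apply, id, d1, d2, d3, d4] at h
  simpa using h.symm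

lemma isProbabilityMeasure_fjltEntryMeasure {q : ℝ} (hq0 : 0 < q) (hq1 : q ≤ 1) :
    IsProbabilityMeasure (fjltEntryMeasure q) := by
  refine ⟨?_⟩
  have : q.toNNReal + (1 - q).toNNReal = 1 := by
    rw [← Real.toNNReal_add hq0.le (by linarith)]
    simp
  simp only [fjltEntryMeasure, Measure.add_apply, Measure.smul_apply, measure_univ]
  simp only [ENNReal.smul_def, smul_eq_mul, mul_one]
  exact_mod_cast this

lemma isProbabilityMeasure_signMeasure : IsProbabilityMeasure signMeasure := by
  refine ⟨?_⟩
  simp only [signMeasure, Measure.add_apply, Measure.smul_apply, measure_univ]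
  simp only [ENNReal.smul_def, smul_eq_mul, mul_one]
  norm_cast
  exact (by rw [← two_mul]; exact mul_inv_cancel₀ two_ne_zero)

lemma integrable_pow_fjltEntryMeasure (q : ℝ) (n : ℕ) :
    Integrable (fun y : ℝ => y ^ n) (fjltEntryMeasure q) :=
  (((memLp_id_gaussianReal (n : ℝ≥0)).integrable_pow_of_le (p := n)
    le_rfl).smul_measure_nnreal).add_measure ((integrable_dirac (by simp)).smul_measure_nnreal)

lemma memLp_id_fjltEntryMeasure (q : ℝ) : MemLp id 4 (fjltEntryMeasure q) := by
  refine (integrable_norm_rpow_iff aestronglyMeasurable_id (by norm_num) (by norm_num)).1 ?_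
  refine (integrable_pow_fjltEntryMeasure q 4).congr (.of_forall fun y => ?_)
  have : ((4 : ℝ≥0∞).toReal) = ((4 : ℕ) : ℝ) := by norm_num
  simp only [id, this, Real.rpow_natCast, Real.norm_eq_abs]
  exact (Even.pow_abs (by decide) y).symm

lemma integral_pow_fjltEntryMeasure {q : ℝ} (hq0 : 0 < q) {n : ℕ} (hn : n ≠ 0) :
    ∫ y, y ^ n ∂fjltEntryMeasure q = q * ∫ y, y ^ n ∂gaussianReal 0 q.toNNReal⁻¹ := by
  have hg : Integrable (fun y : ℝ => y ^ n) (gaussianReal 0 q.toNNReal⁻¹) :=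
    (memLp_id_gaussianReal (n : ℝ≥0)).integrable_pow_of_le (p := n) le_rfl
  rw [fjltEntryMeasure, integral_add_measure (hg.smul_measure_nnreal)
    ((integrable_dirac (by simp)).smul_measure_nnreal)]
  simp [integral_smul_nnreal_measure, hn, NNReal.smul_def, hq0.le]

lemma integral_signMeasure (f : ℝ → ℝ) :
    ∫ y, f y ∂signMeasure = (f (-1) + f 1) / 2 := by
  rw [signMeasure, integral_add_measure ((integrable_dirac (by simp)).smul_measure_nnreal)
    ((integrable_dirac (by simp)).smul_measure_nnreal)]
  simp [integral_smul_nnreal_measure, NNReal.smul_def]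
  ring

lemma ae_signMeasure : ∀ᵐ y ∂signMeasure, y ^ 2 = 1 := by
  have hs : MeasurableSet {y : ℝ | y ^ 2 = 1} := (measurableSet_singleton _).preimage (by fun_prop)
  rw [signMeasure, ae_add_measure_iff]
  constructor <;> refine Measure.ae_smul_measure ?_ _ <;> rw [ae_dirac_iff hs] <;> norm_num

lemma integral_id_fjltEntryMeasure {q : ℝ} (hq0 : 0 < q) :
    ∫ y, y ∂fjltEntryMeasure q = 0 := by
  simpa using integral_pow_fjltEntryMeasure hq0 one_ne_zero

lemma integral_sq_fjltEntryMeasure {q : ℝ} (hq0 : 0 < q) :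
    ∫ y, y ^ 2 ∂fjltEntryMeasure q = 1 := by
  have h := variance_fun_id_gaussianReal (μ := 0) (v := q.toNNReal⁻¹)
  rw [variance_of_integral_eq_zero (by fun_prop) (by simp)] at h
  rw [integral_pow_fjltEntryMeasure hq0 two_ne_zero, h]
  simp [hq0.le, hq0.ne']

lemma integral_pow_four_fjltEntryMeasure {q : ℝ} (hq0 : 0 < q) :
    ∫ y, y ^ 4 ∂fjltEntryMeasure q = 3 / q := by
  rw [integral_pow_fjltEntryMeasure hq0 four_ne_zero, integral_pow_four_gaussianReal]
  simp only [NNReal.coe_inv, Real.coe_toNNReal _ hq0.le]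
  field_simp

section PiMoments

variable {ν : Measure ℝ} [IsProbabilityMeasure ν] {t : ℝ} {ι κ : Type*} [Fintype ι] [Fintype κ]

lemma iIndepFun_eval_pi : iIndepFun (fun a (p : ι → ℝ) => p a) (Measure.pi fun _ => ν) :=
  iIndepFun_pi (X := fun _ => id) fun _ => aemeasurable_id

lemma integral_pow_eval_pi (a : ι) (n : ℕ) :
    ∫ p : ι → ℝ, p a ^ n ∂(Measure.pi fun _ => ν) = ∫ y, y ^ n ∂ν :=
  integral_comp_eval (μ := fun _ : ι => ν) (f := fun y : ℝ => y ^ n) (by fun_prop)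

lemma memLp_eval_pi (hLp : MemLp id 4 ν) (a : ι) :
    MemLp (fun p : ι → ℝ => p a) 4 (Measure.pi fun _ => ν) :=
  hLp.comp_measurePreserving (measurePreserving_eval (fun _ => ν) a)

/-- Moments of a linear combination of distinct coordinates under a product measure. -/
lemma integral_pi_sum_sq_and_pow_four (hLp : MemLp id 4 ν) (h1 : ∫ y, y ∂ν = 0)
    (h2 : ∫ y, y ^ 2 ∂ν = 1) (h4 : ∫ y, y ^ 4 ∂ν = t) {g : κ → ι} (hg : g.Injective)
    (c : κ → ℝ) :
    ∫ p : ι → ℝ, (∑ a, p (g a) * c a) ^ 2 ∂(Measure.pi fun _ => ν) = ∑ a, c a ^ 2 ∧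
    ∫ p : ι → ℝ, (∑ a, p (g a) * c a) ^ 4 ∂(Measure.pi fun _ => ν)
      = 3 * (∑ a, c a ^ 2) ^ 2 + (t - 3) * ∑ a, c a ^ 4 :=
  (iIndepFun_eval_pi.precomp hg).integral_sum_sq_and_pow_four (fun a => by fun_prop)
    (fun a => memLp_eval_pi hLp (g a))
    (fun a => by simpa using (integral_pow_eval_pi (ν := ν) (g a) 1).trans (by simpa using h1))
    (fun a => (integral_pow_eval_pi (g a) 2).trans h2)
    (fun a => (integral_pow_eval_pi (g a) 4).trans h4) c univ

lemma MeasureTheory.MemLp.sq_of_four {Ω : Type*} {_ : MeasurableSpace Ω} {μ : Measure Ω}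
    [IsFiniteMeasure μ] {X : Ω → ℝ} (hX : MemLp X 4 μ) : MemLp (fun ω => X ω ^ 2) 2 μ := by
  refine (memLp_two_iff_integrable_sq (hX.aestronglyMeasurable.pow 2)).2 ?_
  have h : Integrable (fun ω => X ω ^ 4) μ :=
    MemLp.integrable_pow_of_le (p := 4) (by simpa using hX) le_rfl
  simpa [← pow_mul] using h

/-- Moments of the squared norm of the image of a fixed vector under a random matrix with
independent centred entries of unit variance. -/
lemma integral_pi_sum_sq_norm (hLp : MemLp id 4 ν) (h1 : ∫ y, y ∂ν = 0)
    (h2 : ∫ y, y ^ 2 ∂ν = 1) (h4 : ∫ y, y ^ 4 ∂ν = t) (u : ι → ℝ) :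
    ∫ p : κ × ι → ℝ, (∑ i, (∑ f, p (i, f) * u f) ^ 2) ∂(Measure.pi fun _ => ν)
      = Fintype.card κ * ∑ f, u f ^ 2 ∧
    ∫ p : κ × ι → ℝ, (∑ i, (∑ f, p (i, f) * u f) ^ 2) ^ 2 ∂(Measure.pi fun _ => ν)
      = Fintype.card κ * (2 * (∑ f, u f ^ 2) ^ 2 + (t - 3) * ∑ f, u f ^ 4)
        + (Fintype.card κ * ∑ f, u f ^ 2) ^ 2 := by
  classical
  set μ : Measure (κ × ι → ℝ) := Measure.pi fun _ => ν
  set Z : κ → (κ × ι → ℝ) → ℝ := fun i p => (∑ f, p (i, f) * u f) ^ 2 with hZ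
  have hmom : ∀ i, ∫ p, Z i p ∂μ = ∑ f, u f ^ 2 ∧
      ∫ p, (∑ f, p (i, f) * u f) ^ 4 ∂μ
        = 3 * (∑ f, u f ^ 2) ^ 2 + (t - 3) * ∑ f, u f ^ 4 := fun i =>
    integral_pi_sum_sq_and_pow_four hLp h1 h2 h4 (g := fun f => (i, f))
      (fun f g h => by simpa using h) u
  have hZLp : ∀ i, MemLp (Z i) 2 μ := fun i =>
    (memLp_finsetSum univ fun f _ => (memLp_eval_pi hLp (i, f)).mul_const (u f)).sq_of_four
  have hmean : ∫ p, (∑ i, Z i p) ∂μ = Fintype.card κ * ∑ f, u f ^ 2 := by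
    rw [integral_finsetSum _ fun i _ => (hZLp i).integrable one_le_two]
    simp [hmom]
  have hindep : Set.Pairwise (↑(univ : Finset κ)) fun i j => Z i ⟂ᵢ[μ] Z j := by
    intro i _ j _ hij
    have hdisj : Disjoint (({i} : Finset κ) ×ˢ (univ : Finset ι)) ({j} ×ˢ univ) := by
      rw [Finset.disjoint_left]
      rintro ⟨a, f⟩ h h'
      simp only [Finset.mem_product, Finset.mem_singleton, Finset.mem_univ, and_true] at h h'
      exact hij (h.symm.trans h')
    have h := (iIndepFun_eval_pi (ν := ν) (ι := κ × ι)).indepFun_finset _ _ hdisj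
      fun a => by fun_prop
    exact h.comp
      (φ := fun w : ({i} ×ˢ univ : Finset (κ × ι)) → ℝ =>
        (∑ f, w ⟨(i, f), by simp⟩ * u f) ^ 2)
      (ψ := fun w : ({j} ×ˢ univ : Finset (κ × ι)) → ℝ =>
        (∑ f, w ⟨(j, f), by simp⟩ * u f) ^ 2) (by fun_prop) (by fun_prop)
  have hvar : ∀ i, variance (Z i) μ = 2 * (∑ f, u f ^ 2) ^ 2 + (t - 3) * ∑ f, u f ^ 4 := by
    intro i
    have hZ4 : ∫ p, (Z i ^ 2) p ∂μ = ∫ p, (∑ f, p (i, f) * u f) ^ 4 ∂μ :=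
      integral_congr_ae (.of_forall fun p => by simp [hZ, ← pow_mul])
    rw [variance_eq_sub (hZLp i), (hmom i).1, hZ4, (hmom i).2]
    ring
  have hsum := IndepFun.variance_sum (fun i _ => hZLp i) hindep
  rw [variance_eq_sub (memLp_finsetSum' univ fun i _ => hZLp i)] at hsum
  simp only [hvar, Finset.sum_const, Finset.card_univ, nsmul_eq_mul, Pi.pow_apply,
    Finset.sum_apply, hmean] at hsum
  exact ⟨hmean, by linarith⟩

end PiMoments

lemma hadamardMat_eq_prod (m : ℕ) (f j : Fin (2 ^ m)) :
    hadamardMat m f j =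
      (∏ b ∈ Finset.range m, if f.val.testBit b && j.val.testBit b then (-1 : ℝ) else 1) /
        Real.sqrt (2 ^ m) := by
  rw [hadamardMat, ← Finset.prod_pow_eq_pow_sum]
  congr 1
  exact Finset.prod_congr rfl fun b _ => by split_ifs <;> simp

lemma hadamardMat_sq (m : ℕ) (f j : Fin (2 ^ m)) : hadamardMat m f j ^ 2 = 1 / 2 ^ m := by
  rw [hadamardMat, div_pow, Real.sq_sqrt (by positivity), ← pow_mul, mul_comm, pow_mul]
  simp

lemma sum_hadamardMat_mul_of_ne (m : ℕ) {j l : Fin (2 ^ m)} (hjl : j ≠ l) :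
    ∑ f, hadamardMat m f j * hadamardMat m f l = 0 := by
  obtain ⟨b₀, hb₀⟩ : ∃ b, j.val.testBit b ≠ l.val.testBit b := by
    by_contra! h
    exact hjl (Fin.ext (Nat.eq_of_testBit_eq h))
  have hb₀m : b₀ < m := by
    by_contra! h
    have hlt : ∀ i : Fin (2 ^ m), i.val.testBit b₀ = false := fun i =>
      Nat.testBit_lt_two_pow (i.2.trans_le (Nat.pow_le_pow_right (by norm_num) h))
    exact hb₀ ((hlt j).trans (hlt l).symm)
  let flip : Fin (2 ^ m) → Fin (2 ^ m) := fun f =>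
    ⟨f.val ^^^ 2 ^ b₀, Nat.xor_lt_two_pow f.2 (Nat.pow_lt_pow_right (by norm_num) hb₀m)⟩
  have hflip : Function.Involutive flip := fun f => Fin.ext (by simp [flip])
  have hneg : ∀ f, hadamardMat m (flip f) j * hadamardMat m (flip f) l
      = -(hadamardMat m f j * hadamardMat m f l) := by
    intro f
    simp only [hadamardMat_eq_prod, div_mul_div_comm, ← Finset.prod_mul_distrib]
    rw [← neg_div]
    congr 1
    rw [← Finset.mul_prod_erase _ _ (Finset.mem_range.2 hb₀m),
      ← Finset.mul_prod_erase _ _ (Finset.mem_range.2 hb₀m), ← neg_mul]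
    congr 1
    · simp only [flip, Nat.testBit_xor, Nat.testBit_two_pow_self]
      revert hb₀
      cases f.val.testBit b₀ <;> cases j.val.testBit b₀ <;> cases l.val.testBit b₀ <;> simp
    · refine Finset.prod_congr rfl fun b hb => ?_
      have : b₀ ≠ b := (Finset.ne_of_mem_erase hb).symm
      simp [flip, Nat.testBit_xor, this]
  have h := Equiv.sum_comp hflip.toPerm fun f => hadamardMat m f j * hadamardMat m f l
  simp only [Function.Involutive.coe_toPerm, hneg, Finset.sum_neg_distrib] at h
  linarith

/-- The normalized Hadamard matrix is an isometry. -/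
lemma sum_sq_sum_hadamardMat_mul (m : ℕ) (y : Fin (2 ^ m) → ℝ) :
    ∑ f, (∑ j, hadamardMat m f j * y j) ^ 2 = ∑ j, y j ^ 2 := by
  have horth : ∀ j l, ∑ f, hadamardMat m f j * hadamardMat m f l = if j = l then 1 else 0 := by
    intro j l
    split_ifs with h
    · subst h
      simp [← sq, hadamardMat_sq]
    · exact sum_hadamardMat_mul_of_ne m h
  calc ∑ f, (∑ j, hadamardMat m f j * y j) ^ 2
      = ∑ j, ∑ l, (∑ f, hadamardMat m f j * hadamardMat m f l) * (y j * y l) := by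
        simp only [sq, Finset.sum_mul_sum]
        rw [Finset.sum_comm]
        refine Finset.sum_congr rfl fun j _ => ?_
        rw [Finset.sum_comm]
        refine Finset.sum_congr rfl fun l _ => ?_
        rw [Finset.sum_mul]
        exact Finset.sum_congr rfl fun f _ => by ring
    _ = ∑ j, y j ^ 2 := by simp [horth, sq]

/-- The vector `H·D·x`, for the diagonal matrix with diagonal `D`. -/
noncomputable def hadamardImage (m : ℕ) (x D : Fin (2 ^ m) → ℝ) (f : Fin (2 ^ m)) : ℝ :=
  ∑ j, D j * (hadamardMat m f j * x j)

lemma sum_fjltEntry_mul {m k : ℕ} (P : (Fin k × Fin (2 ^ m)) → ℝ) (D x : Fin (2 ^ m) → ℝ)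
    (i : Fin k) :
    ∑ j, fjltEntry P D i j * x j = ∑ f, P (i, f) * hadamardImage m x D f := by
  simp only [fjltEntry, hadamardImage, Finset.sum_mul, Finset.mul_sum]
  rw [Finset.sum_comm]
  exact Finset.sum_congr rfl fun f _ => Finset.sum_congr rfl fun j _ => by ring

lemma ae_pi_signMeasure {ι : Type*} [Fintype ι] :
    ∀ᵐ D : ι → ℝ ∂(Measure.pi fun _ => signMeasure), ∀ j, D j ^ 2 = 1 :=
  ae_all_iff.2 fun j =>
    (Measure.quasiMeasurePreserving_eval (fun _ : ι => signMeasure) j).ae ae_signMeasure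

lemma ae_sum_sq_hadamardImage (m : ℕ) (x : Fin (2 ^ m) → ℝ) :
    ∀ᵐ D ∂(Measure.pi fun _ => signMeasure), ∑ f, hadamardImage m x D f ^ 2 = ∑ j, x j ^ 2 := by
  filter_upwards [ae_pi_signMeasure] with D hD
  simp only [hadamardImage, mul_left_comm (D _)]
  rw [sum_sq_sum_hadamardMat_mul]
  simp [mul_pow, hD]

lemma memLp_top_eval_signMeasure {ι : Type*} [Fintype ι] (j : ι) :
    MemLp (fun D : ι → ℝ => D j) ∞ (Measure.pi fun _ => signMeasure) := by
  refine memLp_top_of_bound (measurable_pi_apply j).aestronglyMeasurable 1 ?_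
  filter_upwards [ae_pi_signMeasure] with D hD
  exact abs_le_one_iff_mul_self_le_one.2 (by rw [← sq, hD j])

lemma memLp_top_hadamardImage (m : ℕ) (x : Fin (2 ^ m) → ℝ) (f : Fin (2 ^ m)) :
    MemLp (fun D => hadamardImage m x D f) ∞ (Measure.pi fun _ => signMeasure) :=
  memLp_finsetSum _ fun j _ => (memLp_top_eval_signMeasure j).mul_const _

lemma integrable_pow_four_hadamardImage (m : ℕ) (x : Fin (2 ^ m) → ℝ) (f : Fin (2 ^ m)) :
    Integrable (fun D => hadamardImage m x D f ^ 4) (Measure.pi fun _ => signMeasure) :=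
  MemLp.integrable_pow_of_le (p := 4) ((memLp_top_hadamardImage m x f).mono_exponent le_top) le_rfl

lemma integral_sum_pow_four_hadamardImage (m : ℕ) (x : Fin (2 ^ m) → ℝ) :
    ∫ D, ∑ f, hadamardImage m x D f ^ 4 ∂(Measure.pi fun _ => signMeasure)
      = (3 * (∑ j, x j ^ 2) ^ 2 - 2 * ∑ j, x j ^ 4) / 2 ^ m := by
  have := isProbabilityMeasure_signMeasure
  have hLp : MemLp id 4 signMeasure := by
    refine (memLp_top_of_bound aestronglyMeasurable_id 1 ?_).mono_exponent le_top
    filter_upwards [ae_signMeasure] with y hy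
    exact abs_le_one_iff_mul_self_le_one.2 (by simp [← sq, hy])
  rw [integral_finsetSum _ fun f _ => integrable_pow_four_hadamardImage m x f]
  have h : ∀ f, ∫ D, hadamardImage m x D f ^ 4 ∂(Measure.pi fun _ => signMeasure)
      = (3 * (∑ j, x j ^ 2) ^ 2 - 2 * ∑ j, x j ^ 4) / (2 ^ m) ^ 2 := by
    intro f
    have hmom := (integral_pi_sum_sq_and_pow_four (t := 1) hLp
      (by rw [integral_signMeasure]; norm_num) (by rw [integral_signMeasure]; norm_num)
      (by rw [integral_signMeasure]; norm_num) Function.injective_id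
      fun j => hadamardMat m f j * x j).2
    have h4 : ∀ j, hadamardMat m f j ^ 4 = 1 / (2 ^ m) ^ 2 := fun j => by
      rw [show 4 = 2 * 2 from rfl, pow_mul, hadamardMat_sq, div_pow, one_pow]
    simp only [id, mul_pow, hadamardMat_sq, h4, ← Finset.mul_sum] at hmom
    refine hmom.trans ?_
    field_simp
    ring
  simp only [h, Finset.sum_const, Finset.card_univ, Fintype.card_fin, nsmul_eq_mul]
  push_cast
  field_simp

/-- For the FJLT `Φ` and every fixed `x ∈ ℝ^d` (`d = 2^m`),
`Var[(1/k)·‖Φx‖₂²] = (1/k)·(2 + (9/d)·(1/q − 1))·‖x‖₂⁴ − (6/(d·k))·(1/q − 1)·‖x‖₄⁴`. -/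
theorem fjlt_variance_exact
    {Ω : Type*} [MeasurableSpace Ω] (Pr : Measure Ω) [IsProbabilityMeasure Pr]
    (m k : ℕ) (hk : 0 < k) (q : ℝ) (hq0 : 0 < q) (hq1 : q ≤ 1)
    (P : Ω → (Fin k × Fin (2 ^ m)) → ℝ) (hPmeas : Measurable P)
    (hPlaw : Measure.map P Pr = Measure.pi (fun _ => fjltEntryMeasure q))
    (D : Ω → Fin (2 ^ m) → ℝ) (hDmeas : Measurable D)
    (hDlaw : Measure.map D Pr = Measure.pi (fun _ => signMeasure))
    (hindep : IndepFun P D Pr)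
    (x : Fin (2 ^ m) → ℝ) :
    variance (fun ω =>
        (1 / (k : ℝ)) * ∑ i : Fin k, (∑ j, fjltEntry (P ω) (D ω) i j * x j) ^ 2) Pr
      = (1 / (k : ℝ)) * (2 + (9 / (2 ^ m : ℝ)) * (1 / q - 1)) * (∑ j, (x j) ^ 2) ^ 2
        - (6 / ((2 ^ m : ℝ) * (k : ℝ))) * (1 / q - 1) * (∑ j, (x j) ^ 4) := by
  have := isProbabilityMeasure_fjltEntryMeasure hq0 hq1
  have := isProbabilityMeasure_signMeasure
  set μ : Measure (Fin k × Fin (2 ^ m) → ℝ) := Measure.pi fun _ => fjltEntryMeasure q with hμ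
  set ρ : Measure (Fin (2 ^ m) → ℝ) := Measure.pi fun _ => signMeasure
  set W : (Fin k × Fin (2 ^ m) → ℝ) × (Fin (2 ^ m) → ℝ) → ℝ := fun z =>
    ∑ i, (∑ f, z.1 (i, f) * hadamardImage m x z.2 f) ^ 2 with hW
  have hpres : MeasurePreserving (fun ω => (P ω, D ω)) Pr (μ.prod ρ) :=
    ⟨hPmeas.prodMk hDmeas, by
      rw [hindep.map_prod_eq_prod_map_map hPmeas.aemeasurable hDmeas.aemeasurable, hPlaw, hDlaw]⟩
  have hWLp : MemLp W 2 (μ.prod ρ) := by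
    refine memLp_finsetSum _ fun i _ => MemLp.sq_of_four ?_
    refine memLp_finsetSum _ fun f _ => ?_
    exact ((memLp_top_hadamardImage m x f).comp_snd μ).mul'
      ((memLp_eval_pi (memLp_id_fjltEntryMeasure q) (i, f)).comp_fst ρ)
  have hcond := fun D => integral_pi_sum_sq_norm (κ := Fin k) (memLp_id_fjltEntryMeasure q)
    (integral_id_fjltEntryMeasure hq0) (integral_sq_fjltEntryMeasure hq0)
    (integral_pow_four_fjltEntryMeasure hq0) (hadamardImage m x D)
  simp only [Fintype.card_fin] at hcond
  have hmean : ∫ z, W z ∂(μ.prod ρ) = k * ∑ j, x j ^ 2 := by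
    rw [integral_prod_symm _ (hWLp.integrable one_le_two)]
    simp only [hW, hμ, (hcond _).1]
    rw [integral_congr_ae (g := fun _ => k * ∑ j, x j ^ 2)]
    · simp
    · filter_upwards [ae_sum_sq_hadamardImage m x] with D hD
      rw [hD]
  have hsq : ∫ z, (W ^ 2) z ∂(μ.prod ρ)
      = k * (2 * (∑ j, x j ^ 2) ^ 2 + (3 / q - 3) *
          ((3 * (∑ j, x j ^ 2) ^ 2 - 2 * ∑ j, x j ^ 4) / 2 ^ m)) + (k * ∑ j, x j ^ 2) ^ 2 := by
    rw [integral_prod_symm (W ^ 2) hWLp.integrable_sq]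
    simp only [hW, hμ, Pi.pow_apply, (hcond _).2]
    rw [integral_congr_ae (g := fun D => k * (2 * (∑ j, x j ^ 2) ^ 2 + (3 / q - 3) *
        ∑ f, hadamardImage m x D f ^ 4) + (k * ∑ j, x j ^ 2) ^ 2)]
    · have hint : Integrable (fun D => ∑ f, hadamardImage m x D f ^ 4) ρ :=
        integrable_finsetSum _ fun f _ => integrable_pow_four_hadamardImage m x f
      rw [integral_add (((integrable_const _).fun_add (hint.const_mul _)).const_mul _)
          (integrable_const _), integral_const_mul,
        integral_add (integrable_const _) (hint.const_mul _), integral_const_mul (3 / q - 3),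
        integral_sum_pow_four_hadamardImage]
      simp
    · filter_upwards [ae_sum_sq_hadamardImage m x] with D hD
      rw [hD]
  have hfun : (fun ω => (1 / (k : ℝ)) * ∑ i : Fin k, (∑ j, fjltEntry (P ω) (D ω) i j * x j) ^ 2)
      = fun ω => (1 / (k : ℝ)) * W (P ω, D ω) := by
    simp only [hW, sum_fjltEntry_mul]
  have hk' : (k : ℝ) ≠ 0 := by exact_mod_cast hk.ne'
  rw [hfun, variance_const_mul, hpres.variance_fun_comp hWLp.aemeasurable, variance_eq_sub hWLp,
    hmean, hsq]
  field_simp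
  ring
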